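/- arXiv:1805.09047 — 3 statements merged into one kernel-verified Lean document; each statement's English description precedes it below -/
import Mathlib

section
/- Let G be a finite group, let Π be a subset of G that is a union of conjugacy classes of elements of G, let ℳ₁, …, ℳ_t be distinct conjugacy classes of maximal subgroups of G, and let 𝒞 = ℳ₁ ∪ ⋯ ∪ ℳ_t. Suppose that every element of Π lies in exactly one subgroup belonging to 𝒞 and that every subgroup in 𝒞 contains at least one element of Π. For each i, let Π_i be the set of elements of Π lying in some subgroup of ℳ_i, and fix a representative M_i ∈ ℳ_i. For a maximal subgroup M of G not in 𝒞, define c(M) := Σ_{i=1}^{t} |M ∩ Π_i| / |M_i ∩ Π_i|. If c(M) ≤ 1 for every maximal subgroup M of G not in 𝒞, then for every collection ℬ of maximal subgroups of G whose union contains Π, one has |𝒞| ≤ |ℬ|. Moreover, if c(M) < 1 for every maximal subgroup M of G not in 𝒞, then 𝒞 is the unique collection of maximal subgroups of minimum size whose union contains Π. -/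
open scoped ENat

/-- The class of subgroups conjugate to `H`. -/
def conjugatesOfSubgroup {G : Type*} [Group G] (H : Subgroup G) : Set (Subgroup G) :=
  {K : Subgroup G | ∃ g : G, K = Subgroup.map (MulAut.conj g).toMonoidHom H}

theorem conjugatesOfSubgroup_subset {G : Type*} [Group G] {H K : Subgroup G}
    (h : K ∈ conjugatesOfSubgroup H) : conjugatesOfSubgroup K ⊆ conjugatesOfSubgroup H := by
  obtain ⟨x, rfl⟩ := h
  rintro _ ⟨y, rfl⟩
  refine ⟨y * x, ?_⟩
  rw [Subgroup.map_map]
  congr 1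
  ext z
  simp

theorem mem_conjugatesOfSubgroup_symm {G : Type*} [Group G] {H K : Subgroup G}
    (h : K ∈ conjugatesOfSubgroup H) : H ∈ conjugatesOfSubgroup K := by
  obtain ⟨x, rfl⟩ := h
  refine ⟨x⁻¹, ?_⟩
  rw [Subgroup.map_map]
  convert (Subgroup.map_id H).symm using 2
  ext z
  simp [mul_assoc]

theorem conjugatesOfSubgroup_eq_of_mem {G : Type*} [Group G] {H K : Subgroup G}
    (h : K ∈ conjugatesOfSubgroup H) : conjugatesOfSubgroup K = conjugatesOfSubgroup H :=
  (conjugatesOfSubgroup_subset h).antisymm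
    (conjugatesOfSubgroup_subset (mem_conjugatesOfSubgroup_symm h))

/-- Conjugate subgroups meet a conjugation-invariant set in equally many elements. -/
theorem ncard_inter_eq_of_mem_conjugatesOfSubgroup {G : Type*} [Group G] {P : Set G}
    (hP : ∀ g ∈ P, ∀ x : G, x * g * x⁻¹ ∈ P) {H K : Subgroup G}
    (h : K ∈ conjugatesOfSubgroup H) :
    ((K : Set G) ∩ P).ncard = ((H : Set G) ∩ P).ncard := by
  obtain ⟨x, rfl⟩ := h
  rw [← Set.ncard_image_of_injective ((H : Set G) ∩ P) (MulAut.conj x).injective]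
  congr 1
  ext z
  constructor
  · rintro ⟨⟨y, hy, rfl⟩, hz⟩
    refine ⟨y, ⟨hy, ?_⟩, rfl⟩
    simpa [mul_assoc] using hP _ hz x⁻¹
  · rintro ⟨y, ⟨hy, hyP⟩, rfl⟩
    exact ⟨⟨y, hy, rfl⟩, by simpa using hP y hyP x⟩

open Classical in
/-- Double counting of weighted incidences between elements and subgroups. -/
theorem sum_sum_mem_eq_sum_card_mul {G : Type*} [Group G] [Fintype G] (w : G → ℝ)
    (B : Finset (Subgroup G)) :
    ∑ H ∈ B, ∑ g with g ∈ H, w g = ∑ g, ((B.filter (g ∈ ·)).card : ℝ) * w g := by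
  simp_rw [Finset.sum_filter]
  rw [Finset.sum_comm]
  refine Finset.sum_congr rfl fun g _ => ?_
  rw [← Finset.sum_filter, Finset.sum_const, nsmul_eq_mul]

open Classical in
/-- If `C` covers every point of `P` exactly once, then a nonnegative weight supported on `P`
gives the members of any cover `B` of `P` at least the total weight of the members of `C`. -/
theorem sum_weight_le_sum_weight_of_cover {G : Type*} [Group G] [Fintype G] {P : Set G}
    {w : G → ℝ} (hw : ∀ g, 0 ≤ w g) (hsupp : ∀ g ∉ P, w g = 0) {B C : Finset (Subgroup G)}
    (hC : ∀ g ∈ P, ∃! H : Subgroup G, H ∈ C ∧ g ∈ H) (hB : P ⊆ ⋃ H ∈ B, (H : Set G)) :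
    ∑ H ∈ C, ∑ g with g ∈ H, w g ≤ ∑ H ∈ B, ∑ g with g ∈ H, w g := by
  rw [sum_sum_mem_eq_sum_card_mul, sum_sum_mem_eq_sum_card_mul]
  refine Finset.sum_le_sum fun g _ => ?_
  by_cases hg : g ∈ P
  · refine mul_le_mul_of_nonneg_right (Nat.cast_le.2 ?_) (hw g)
    obtain ⟨H, -, hH⟩ := hC g hg
    have hle : (C.filter (g ∈ ·)).card ≤ 1 := Finset.card_le_one.2 fun K hK L hL =>
      (hH K (by simpa using hK)).trans (hH L (by simpa using hL)).symm
    refine hle.trans (Finset.card_pos.2 ?_)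
    obtain ⟨K, hK, hgK⟩ := Set.mem_iUnion₂.1 (hB hg)
    exact ⟨K, Finset.mem_filter.2 ⟨hK, hgK⟩⟩
  · simp [hsupp g hg]

theorem statement12 (G : Type*) [Group G] [Finite G] (Pset : Set G)
    (hconj : ∀ g ∈ Pset, ∀ x : G, x * g * x⁻¹ ∈ Pset)
    (t : ℕ) (M : Fin t → Set (Subgroup G))
    (hclass : ∀ i : Fin t, ∃ M₀ : Subgroup G, IsCoatom M₀ ∧
      M i = {K : Subgroup G | ∃ g : G, K = Subgroup.map (MulAut.conj g).toMonoidHom M₀})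
    (hdist : Function.Injective M)
    (C : Set (Subgroup G)) (hC : C = ⋃ i : Fin t, M i)
    (hpart : ∀ g ∈ Pset, ∃! H : Subgroup G, H ∈ C ∧ g ∈ H)
    (hmeet : ∀ H ∈ C, ∃ g ∈ Pset, g ∈ H)
    (Pt : Fin t → Set G) (hPt : ∀ i : Fin t, Pt i = {g ∈ Pset | ∃ H ∈ M i, g ∈ H})
    (Mrep : Fin t → Subgroup G) (hMrep : ∀ i : Fin t, Mrep i ∈ M i)
    (c : Subgroup G → ℝ)
    (hc : ∀ K : Subgroup G, c K =
      ∑ i : Fin t, (((K : Set G) ∩ Pt i).ncard : ℝ) / (((Mrep i : Set G) ∩ Pt i).ncard : ℝ)) :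
    ((∀ K : Subgroup G, IsCoatom K → K ∉ C → c K ≤ 1) →
      ∀ B : Set (Subgroup G), (∀ H ∈ B, IsCoatom H) →
        Pset ⊆ (⋃ H ∈ B, (H : Set G)) → C.ncard ≤ B.ncard) ∧
    ((∀ K : Subgroup G, IsCoatom K → K ∉ C → c K < 1) →
      ∀ B : Set (Subgroup G), (∀ H ∈ B, IsCoatom H) →
        Pset ⊆ (⋃ H ∈ B, (H : Set G)) → B.ncard ≤ C.ncard → B = C) := by
  classical
  have := Fintype.ofFinite G
  have hMC : ∀ i, M i ⊆ C := fun i => hC ▸ Set.subset_iUnion M i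
  have hclass' : ∀ i, ∀ K ∈ M i, M i = conjugatesOfSubgroup K := by
    intro i K hK
    obtain ⟨M₀, -, h⟩ := hclass i
    rw [h] at hK ⊢
    exact (conjugatesOfSubgroup_eq_of_mem hK).symm
  have hinter : ∀ i, ∀ K ∈ M i, (K : Set G) ∩ Pt i = (K : Set G) ∩ Pset := by
    intro i K hK
    rw [hPt]
    ext g
    exact ⟨fun h => ⟨h.1, h.2.1⟩, fun h => ⟨h.1, h.2, K, hK, h.1⟩⟩
  have hcC : ∀ K ∈ C, c K = 1 := by
    intro K hK
    obtain ⟨i, hi⟩ := Set.mem_iUnion.1 (hC ▸ hK)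
    rw [hc, Finset.sum_eq_single i]
    · rw [hinter i K hi, hinter i _ (hMrep i),
        ncard_inter_eq_of_mem_conjugatesOfSubgroup hconj
          (hclass' i _ (hMrep i) ▸ hi)]
      refine div_self (Nat.cast_ne_zero.2 ?_)
      obtain ⟨g, hgP, hgM⟩ := hmeet _ (hMC i (hMrep i))
      exact Set.ncard_ne_zero_of_mem (a := g) ⟨hgM, hgP⟩
    · intro j _ hji
      have hempty : (K : Set G) ∩ Pt j = ∅ := by
        refine Set.eq_empty_of_forall_notMem ?_
        rintro g ⟨hgK, hg⟩
        rw [hPt] at hg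
        obtain ⟨hgP, H, hH, hgH⟩ := hg
        obtain rfl := (hpart g hgP).unique ⟨hMC j hH, hgH⟩ ⟨hK, hgK⟩
        exact hji (hdist ((hclass' j H hH).trans (hclass' i H hi).symm))
      simp [hempty]
    · simp
  let w : G → ℝ := fun g =>
    ∑ i, if g ∈ Pt i then (((Mrep i : Set G) ∩ Pt i).ncard : ℝ)⁻¹ else 0
  have hw : ∀ g, 0 ≤ w g := fun g => Finset.sum_nonneg fun i _ => by positivity
  have hsupp : ∀ g ∉ Pset, w g = 0 := fun g hg => Finset.sum_eq_zero fun i _ =>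
    if_neg fun h => hg (by rw [hPt] at h; exact h.1)
  have hcw : ∀ K, c K = ∑ g with g ∈ K, w g := by
    intro K
    rw [hc, Finset.sum_comm]
    refine Finset.sum_congr rfl fun i _ => ?_
    rw [← Finset.sum_filter, Finset.sum_const, nsmul_eq_mul, div_eq_mul_inv,
      Set.ncard_eq_toFinset_card']
    congr 3
    ext g
    simp
  have hle : ∀ B : Set (Subgroup G), Pset ⊆ (⋃ H ∈ B, (H : Set G)) →
      (C.ncard : ℝ) ≤ ∑ H ∈ B.toFinset, c H := by
    intro B hB
    have key := sum_weight_le_sum_weight_of_cover hw hsupp (B := B.toFinset) (C := C.toFinset)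
      (by simpa using hpart) (by simpa using hB)
    simp_rw [← hcw] at key
    rwa [Finset.sum_congr rfl fun H hH => hcC H (Set.mem_toFinset.1 hH), Finset.sum_const,
      nsmul_one, ← Set.ncard_eq_toFinset_card'] at key
  have hone : ∀ B : Set (Subgroup G), ∑ _H ∈ B.toFinset, (1 : ℝ) = B.ncard := by
    intro B
    rw [Finset.sum_const, nsmul_one, Set.ncard_eq_toFinset_card']
  refine ⟨fun h B hmax hB => ?_, fun h B hmax hB hcard => ?_⟩
  · rw [← Nat.cast_le (α := ℝ), ← hone B]
    refine (hle B hB).trans (Finset.sum_le_sum fun H hH => ?_)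
    by_cases hHC : H ∈ C
    · exact (hcC H hHC).le
    · exact h H (hmax H (Set.mem_toFinset.1 hH)) hHC
  · have hBC : B ⊆ C := by
      intro K hK
      by_contra hKC
      refine hcard.not_gt ?_
      rw [← Nat.cast_lt (α := ℝ), ← hone B]
      refine (hle B hB).trans_lt (Finset.sum_lt_sum (fun H hH => ?_)
        ⟨K, Set.mem_toFinset.2 hK, h K (hmax K hK) hKC⟩)
      by_cases hHC : H ∈ C
      · exact (hcC H hHC).le
      · exact (h H (hmax H (Set.mem_toFinset.1 hH)) hHC).le
    refine hBC.antisymm fun H hH => ?_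
    obtain ⟨g, hgP, hgH⟩ := hmeet H hH
    obtain ⟨K, hK, hgK⟩ := Set.mem_iUnion₂.1 (hB hgP)
    rwa [(hpart g hgP).unique ⟨hH, hgH⟩ ⟨hBC hK, hgK⟩]
end

section
/- Let A be a subset of ℕ and for real x let θ(x) := |{n ∈ A : n ≤ x}|. If there exists a constant c such that log(x)·θ(x^(1/2)) ≤ c·θ(x) for every x > 0, then there exists a constant d such that |{n^k : n ∈ A, k ∈ ℕ, k ≥ 1, n^k ≤ x}| ≤ d·θ(x) for every x > 0. -/
open scoped ENat

theorem finite_sep_natCast_le (A : Set ℕ) (x : ℝ) : {n ∈ A | (n : ℝ) ≤ x}.Finite :=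
  (Set.finite_Iic ⌊x⌋₊).subset fun _ hn => Nat.le_floor hn.2

/-- The powers up to `x` of elements of `A` are either elements of `A`, or have base at most `√x`
and exponent at most `log₂ x`. -/
theorem powers_subset_union_image (A : Set ℕ) (x : ℝ) :
    {m : ℕ | ∃ n ∈ A, ∃ k : ℕ, 1 ≤ k ∧ m = n ^ k ∧ (m : ℝ) ≤ x} ⊆
      {n ∈ A | (n : ℝ) ≤ x} ∪ (fun p : ℕ × ℕ => p.1 ^ p.2) ''
        ({n ∈ A | (n : ℝ) ≤ x ^ ((1 : ℝ) / 2)} ×ˢ Set.Icc 1 ⌊Real.log x / Real.log 2⌋₊) := by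
  rintro m ⟨n, hn, k, hk, rfl, hm⟩
  by_cases hmA : n ^ k ∈ A
  · exact Or.inl ⟨hmA, hm⟩
  have hn2 : 2 ≤ n := by
    by_contra! h
    interval_cases n
    · exact hmA (by rwa [zero_pow (by omega)])
    · exact hmA (by rwa [one_pow])
  have hk2 : 2 ≤ k := by
    by_contra! h
    obtain rfl : k = 1 := by omega
    exact hmA (by rwa [pow_one])
  have hn1 : (2 : ℝ) ≤ n := by exact_mod_cast hn2
  push_cast at hm
  refine Or.inr ⟨(n, k), ⟨⟨hn, ?_⟩, hk, Nat.le_floor ?_⟩, rfl⟩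
  · rw [← Real.sqrt_eq_rpow]
    exact Real.le_sqrt_of_sq_le ((pow_le_pow_right₀ (by linarith) hk2).trans hm)
  · rw [le_div_iff₀ (Real.log_pos one_lt_two), ← Real.log_pow]
    exact Real.log_le_log (by positivity) ((pow_le_pow_left₀ (by norm_num) hn1 k).trans hm)

theorem ncard_powers_le (A : Set ℕ) (x : ℝ) :
    {m : ℕ | ∃ n ∈ A, ∃ k : ℕ, 1 ≤ k ∧ m = n ^ k ∧ (m : ℝ) ≤ x}.ncard ≤
      {n ∈ A | (n : ℝ) ≤ x}.ncard +
        {n ∈ A | (n : ℝ) ≤ x ^ ((1 : ℝ) / 2)}.ncard * ⌊Real.log x / Real.log 2⌋₊ := by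
  have hfin := (finite_sep_natCast_le A (x ^ ((1 : ℝ) / 2))).prod
    (Set.finite_Icc 1 ⌊Real.log x / Real.log 2⌋₊)
  refine (Set.ncard_le_ncard (powers_subset_union_image A x)
    ((finite_sep_natCast_le A x).union (hfin.image _))).trans ((Set.ncard_union_le _ _).trans ?_)
  gcongr
  refine (Set.ncard_image_le hfin).trans_eq ?_
  rw [Set.ncard_prod, Set.ncard_eq_toFinset_card' (Set.Icc 1 _)]
  simp

theorem statement13 (A : Set ℕ) (θ : ℝ → ℝ)
    (hθ : ∀ x : ℝ, θ x = ({n ∈ A | (n : ℝ) ≤ x} : Set ℕ).ncard)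
    (c : ℝ) (hc : ∀ x : ℝ, 0 < x → Real.log x * θ (x ^ ((1 : ℝ) / 2)) ≤ c * θ x) :
    ∃ d : ℝ, ∀ x : ℝ, 0 < x →
      (({m : ℕ | ∃ n ∈ A, ∃ k : ℕ, 1 ≤ k ∧ m = n ^ k ∧ (m : ℝ) ≤ x} : Set ℕ).ncard : ℝ)
        ≤ d * θ x := by
  have hlog2 : 0 < Real.log 2 := Real.log_pos one_lt_two
  have hθ0 : ∀ x, 0 ≤ θ x := fun x => by rw [hθ]; positivity
  refine ⟨1 + |c| / Real.log 2, fun x hx => ?_⟩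
  have hcard : (({m : ℕ | ∃ n ∈ A, ∃ k : ℕ, 1 ≤ k ∧ m = n ^ k ∧ (m : ℝ) ≤ x} : Set ℕ).ncard : ℝ)
      ≤ θ x + θ (x ^ ((1 : ℝ) / 2)) * ⌊Real.log x / Real.log 2⌋₊ := by
    rw [hθ, hθ]
    exact_mod_cast ncard_powers_le A x
  have hpow : θ (x ^ ((1 : ℝ) / 2)) * ⌊Real.log x / Real.log 2⌋₊ ≤ |c| / Real.log 2 * θ x := by
    rcases le_total (Real.log x) 0 with h | h
    · rw [Nat.floor_of_nonpos (div_nonpos_of_nonpos_of_nonneg h hlog2.le), Nat.cast_zero, mul_zero]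
      exact mul_nonneg (by positivity) (hθ0 x)
    · calc θ (x ^ ((1 : ℝ) / 2)) * ⌊Real.log x / Real.log 2⌋₊
          ≤ θ (x ^ ((1 : ℝ) / 2)) * (Real.log x / Real.log 2) :=
            mul_le_mul_of_nonneg_left (Nat.floor_le (div_nonneg h hlog2.le)) (hθ0 _)
        _ = Real.log x * θ (x ^ ((1 : ℝ) / 2)) / Real.log 2 := by ring
        _ ≤ |c| * θ x / Real.log 2 := by
            refine div_le_div_of_nonneg_right ?_ hlog2.le
            exact (hc x hx).trans (mul_le_mul_of_nonneg_right (le_abs_self c) (hθ0 x))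
        _ = |c| / Real.log 2 * θ x := by ring
  linarith
end

section
/- The covering number of the symplectic group Sp(8,2) equals 256; that is, σ(Sp(8,2)) = 256, where Sp(8,2) is the group of 8×8 matrices over the field 𝔽₂ with two elements that preserve the standard symplectic (nondegenerate alternating bilinear) form on 𝔽₂⁸. -/
open scoped ENat

/-- `S` is a cover of the group `G` by proper subgroups: every element of `G`
lies in some member of `S`, and every member of `S` is a proper subgroup. -/
def IsSubgroupCover {G : Type*} [Group G] (S : Finset (Subgroup G)) : Prop :=
  (∀ H ∈ S, H ≠ ⊤) ∧ ∀ g : G, ∃ H ∈ S, g ∈ H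

/-- The covering number `σ(G)`: the least size of a cover of `G` by proper
subgroups, equal to `⊤` (infinity) if no such finite collection exists. -/
noncomputable def coveringNumber (G : Type*) [Group G] : ℕ∞ :=
  sInf {n : ℕ∞ | ∃ S : Finset (Subgroup G), IsSubgroupCover S ∧ (S.card : ℕ∞) = n}

open Matrix

namespace SymplecticCover

section Form

variable {l : Type*} [DecidableEq l] [Fintype l]

/-- The standard symplectic form over `𝔽₂`. -/
def form (x y : l ⊕ l → ZMod 2) : ZMod 2 := x ⬝ᵥ (J l (ZMod 2) *ᵥ y)

theorem form_eq_sum (x y : l ⊕ l → ZMod 2) :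
    form x y = ∑ i, (x (.inl i) * y (.inr i) + x (.inr i) * y (.inl i)) := by
  simp [form, J, dotProduct, fromBlocks_mulVec, Finset.sum_add_distrib,
    ZModModule.neg_eq_self]

theorem form_add_left (x y z : l ⊕ l → ZMod 2) : form (x + y) z = form x z + form y z := by
  simp [form, add_dotProduct]

theorem form_add_right (x y z : l ⊕ l → ZMod 2) : form x (y + z) = form x y + form x z := by
  simp [form, mulVec_add, dotProduct_add]

theorem form_smul_left (c : ZMod 2) (x y : l ⊕ l → ZMod 2) : form (c • x) y = c * form x y := by
  simp [form]

theorem form_smul_right (c : ZMod 2) (x y : l ⊕ l → ZMod 2) : form x (c • y) = c * form x y := by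
  simp [form, mulVec_smul]

theorem form_comm (x y : l ⊕ l → ZMod 2) : form x y = form y x := by
  simp only [form_eq_sum]
  exact Finset.sum_congr rfl fun i _ => by ring

theorem form_self (x : l ⊕ l → ZMod 2) : form x x = 0 := by
  rw [form_eq_sum]
  exact Finset.sum_eq_zero fun i _ => by
    rw [mul_comm (x (.inr i))]
    exact CharTwo.add_self_eq_zero _

theorem eq_zero_of_form_eq_zero {x : l ⊕ l → ZMod 2} (h : ∀ y, form x y = 0) : x = 0 := by
  ext (i | i)
  · have := h (Pi.single (.inr i) 1)
    simpa [form_eq_sum, Pi.single_apply] using this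
  · have := h (Pi.single (.inl i) 1)
    simpa [form_eq_sum, Pi.single_apply] using this

theorem eq_one_of_ne_zero {a : ZMod 2} (h : a ≠ 0) : a = 1 := by
  revert h; revert a; decide

theorem add_eq_zero_iff_eq {ι : Type*} {x y : ι → ZMod 2} : x + y = 0 ↔ x = y := by
  rw [← ZModModule.sub_eq_add, sub_eq_zero]

theorem mem_symplecticGroup_iff_form {A : Matrix (l ⊕ l) (l ⊕ l) (ZMod 2)} :
    A ∈ symplecticGroup l (ZMod 2) ↔ ∀ x y, form (A *ᵥ x) (A *ᵥ y) = form x y := by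
  have key : ∀ x y, form (A *ᵥ x) (A *ᵥ y) = x ⬝ᵥ ((Aᵀ * J l (ZMod 2) * A) *ᵥ y) := by
    intro x y
    rw [form, ← mulVec_mulVec, ← mulVec_mulVec, dotProduct_mulVec x, vecMul_transpose]
  rw [SymplecticGroup.mem_iff']
  refine ⟨fun h x y => by rw [key, h, form], fun h => ?_⟩
  refine Matrix.ext fun i j => ?_
  have := h (Pi.single i 1) (Pi.single j 1)
  rw [key, form] at this
  simpa using this

theorem form_mulVec (g : symplecticGroup l (ZMod 2)) (x y : l ⊕ l → ZMod 2) :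
    form (g.1 *ᵥ x) (g.1 *ᵥ y) = form x y :=
  mem_symplecticGroup_iff_form.1 g.2 x y

theorem ext_mulVec {g h : symplecticGroup l (ZMod 2)} (H : ∀ x, g.1 *ᵥ x = h.1 *ᵥ x) : g = h :=
  Subtype.ext (Matrix.mulVec_injective (funext H))

theorem transvection_aux (u x : l ⊕ l → ZMod 2) :
    (1 + vecMulVec u (J l (ZMod 2) *ᵥ u)) *ᵥ x = x + form x u • u := by
  ext i
  simp [add_mulVec, vecMulVec_mulVec, form, dotProduct_comm x, mul_comm]

/-- The symplectic transvection with centre `u`. -/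
def transvection (u : l ⊕ l → ZMod 2) : symplecticGroup l (ZMod 2) :=
  ⟨1 + vecMulVec u (J l (ZMod 2) *ᵥ u), mem_symplecticGroup_iff_form.2 fun x y => by
    rw [transvection_aux, transvection_aux]
    simp only [form_add_left, form_add_right, form_smul_left, form_smul_right, form_self,
      form_comm u y]
    linear_combination CharTwo.add_self_eq_zero (form x u * form y u)⟩

theorem transvection_mulVec (u x : l ⊕ l → ZMod 2) :
    (transvection u).1 *ᵥ x = x + form x u • u :=
  transvection_aux u x

theorem transvection_mul_self (u : l ⊕ l → ZMod 2) : transvection u * transvection u = 1 := by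
  refine ext_mulVec fun x => ?_
  rw [Submonoid.coe_mul, ← mulVec_mulVec, transvection_mulVec, transvection_mulVec]
  simp [form_add_left, form_smul_left, form_self, add_assoc, ZModModule.add_self]

theorem transvection_inv (u : l ⊕ l → ZMod 2) : (transvection u)⁻¹ = transvection u :=
  inv_eq_of_mul_eq_one_left (transvection_mul_self u)

theorem transvection_zero : transvection (0 : l ⊕ l → ZMod 2) = 1 :=
  ext_mulVec fun x => by simp [transvection_mulVec]

theorem transvection_mulVec_eq_conj (g : symplecticGroup l (ZMod 2)) (u : l ⊕ l → ZMod 2) :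
    transvection (g.1 *ᵥ u) = g * transvection u * g⁻¹ := by
  rw [eq_mul_inv_iff_mul_eq]
  refine ext_mulVec fun x => ?_
  simp only [Submonoid.coe_mul, ← mulVec_mulVec, transvection_mulVec, form_mulVec, mulVec_add,
    mulVec_smul]

/-- The vectors moved by a symplectic matrix. -/
def moved (g : symplecticGroup l (ZMod 2)) : Finset (l ⊕ l → ZMod 2) :=
  Finset.univ.filter fun x => g.1 *ᵥ x ≠ x

theorem moved_transvection_mul_subset (g : symplecticGroup l (ZMod 2)) (w : l ⊕ l → ZMod 2) :
    moved (transvection (g.1 *ᵥ w + w) * g) ⊆ moved g := by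
  intro x
  simp only [moved, Finset.mem_filter, Finset.mem_univ, true_and]
  refine mt fun hx => ?_
  have h : form x (g.1 *ᵥ w) = form x w := by
    rw [← form_mulVec g x w, hx]
  rw [Submonoid.coe_mul, ← mulVec_mulVec, hx, transvection_mulVec, form_add_right, h,
    CharTwo.add_self_eq_zero, zero_smul, add_zero]

theorem moved_transvection_mul_ssubset {g : symplecticGroup l (ZMod 2)} {v : l ⊕ l → ZMod 2}
    (hv : form v (g.1 *ᵥ v) = 1) : moved (transvection (g.1 *ᵥ v + v) * g) ⊂ moved g := by
  refine (Finset.ssubset_iff_of_subset (moved_transvection_mul_subset g v)).2 ⟨v, ?_, ?_⟩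
  · simp only [moved, Finset.mem_filter, Finset.mem_univ, true_and]
    intro h
    rw [h, form_self] at hv
    exact zero_ne_one hv
  · simp only [moved, Finset.mem_filter, Finset.mem_univ, true_and, not_not]
    rw [Submonoid.coe_mul, ← mulVec_mulVec, transvection_mulVec, form_add_right, form_self,
      form_comm, hv, zero_add, one_smul, ← add_assoc, ZModModule.add_self, zero_add]

/-- The symplectic group over `𝔽₂` is generated by its transvections. -/
theorem eq_top_of_transvection_mem {H : Subgroup (symplecticGroup l (ZMod 2))}
    (hH : ∀ u, transvection u ∈ H) : H = ⊤ := by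
  rw [Subgroup.eq_top_iff']
  intro g
  induction hn : (moved g).card using Nat.strong_induction_on generalizing g with
  | _ n ih =>
  subst hn
  by_cases hg : ∃ v, form v (g.1 *ᵥ v) ≠ 0
  · obtain ⟨v, hv⟩ := hg
    exact (H.mul_mem_cancel_left (hH _)).1
      (ih _ (Finset.card_lt_card (moved_transvection_mul_ssubset (eq_one_of_ne_zero hv))) _ rfl)
  push Not at hg
  by_cases h1 : ∀ v, g.1 *ᵥ v = v
  · have : g = 1 := ext_mulVec fun x => by simp [h1 x]
    exact this ▸ H.one_mem
  push Not at h1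
  obtain ⟨v, hv⟩ := h1
  obtain ⟨w, hw⟩ : ∃ w, form v (g.1 *ᵥ w + w) ≠ 0 := by
    by_contra! h
    refine hv (add_eq_zero_iff_eq.1 (eq_zero_of_form_eq_zero fun y => ?_))
    have hy := h (g⁻¹.1 *ᵥ y)
    have hgy : g.1 *ᵥ (g⁻¹.1 *ᵥ y) = y := by
      rw [mulVec_mulVec, ← Submonoid.coe_mul, mul_inv_cancel, Submonoid.coe_one, one_mulVec]
    rw [form_add_right, ← form_mulVec g v (g⁻¹.1 *ᵥ y), hgy] at hy
    rw [form_add_left, add_comm, hy]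
  have hw := eq_one_of_ne_zero hw
  have hsym : form w (g.1 *ᵥ v) = form v (g.1 *ᵥ w) := by
    have := hg (v + w)
    rw [mulVec_add, form_add_left, form_add_right, form_add_right, hg, hg, zero_add, add_zero]
      at this
    exact (CharTwo.add_eq_zero.1 this).symm
  have hstep : form v ((transvection (g.1 *ᵥ w + w) * g).1 *ᵥ v) = 1 := by
    rw [Submonoid.coe_mul, ← mulVec_mulVec, transvection_mulVec, form_add_right, hg,
      form_smul_right, hw, form_add_right, form_mulVec, form_comm (g.1 *ᵥ v), hsym,
      add_comm (form v w),
      ← form_add_right, hw]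
    rfl
  refine (H.mul_mem_cancel_left (hH _)).1 ((H.mul_mem_cancel_left (hH _)).1
    (ih _ (lt_of_lt_of_le (Finset.card_lt_card (moved_transvection_mul_ssubset hstep))
      (Finset.card_le_card (moved_transvection_mul_subset g w))) _ rfl))

end Form

section UpperBound

variable {l : Type*} [DecidableEq l] [Fintype l]

/-- The quadratic form over `𝔽₂` that polarizes to `form` and has linear part `w`. -/
def quadForm (w x : l ⊕ l → ZMod 2) : ZMod 2 := ∑ i, x (.inl i) * x (.inr i) + w ⬝ᵥ x

theorem quadForm_add (w x y : l ⊕ l → ZMod 2) :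
    quadForm w (x + y) = quadForm w x + quadForm w y + form x y := by
  simp only [quadForm, form_eq_sum, dotProduct_add, Pi.add_apply]
  have : ∑ i, (x (.inl i) + y (.inl i)) * (x (.inr i) + y (.inr i)) =
      ∑ i, x (.inl i) * x (.inr i) + ∑ i, y (.inl i) * y (.inr i) +
        ∑ i, (x (.inl i) * y (.inr i) + x (.inr i) * y (.inl i)) := by
    rw [← Finset.sum_add_distrib, ← Finset.sum_add_distrib]
    exact Finset.sum_congr rfl fun i _ => by ring
  rw [this]
  ring

/-- The orthogonal group of `quadForm w` inside the symplectic group. -/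
def orthogonalSubgroup (w : l ⊕ l → ZMod 2) : Subgroup (symplecticGroup l (ZMod 2)) where
  carrier := {g | ∀ x, quadForm w (g.1 *ᵥ x) = quadForm w x}
  one_mem' x := by simp
  mul_mem' {a b} ha hb x := by
    rw [Submonoid.coe_mul, ← mulVec_mulVec, ha, hb]
  inv_mem' {a} ha x := by
    rw [← ha, mulVec_mulVec, ← Submonoid.coe_mul, mul_inv_cancel, Submonoid.coe_one, one_mulVec]

theorem transvection_notMem_orthogonalSubgroup {w v : l ⊕ l → ZMod 2} (hv : v ≠ 0)
    (hq : quadForm w v = 0) : transvection v ∉ orthogonalSubgroup w := by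
  intro h
  refine hv (eq_zero_of_form_eq_zero fun x => ?_)
  by_contra hx
  rw [form_comm] at hx
  have := h x
  rw [transvection_mulVec, eq_one_of_ne_zero hx, one_smul, quadForm_add, hq,
    eq_one_of_ne_zero hx] at this
  simp at this

theorem orthogonalSubgroup_ne_top [Nontrivial l] (w : l ⊕ l → ZMod 2) :
    orthogonalSubgroup w ≠ ⊤ := by
  intro htop
  have hne : ∀ v : l ⊕ l → ZMod 2, v ≠ 0 → quadForm w v = 1 := fun v hv =>
    eq_one_of_ne_zero fun hq =>
      transvection_notMem_orthogonalSubgroup hv hq (htop ▸ Subgroup.mem_top _)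
  obtain ⟨i, j, hij⟩ := exists_pair_ne l
  set x : l ⊕ l → ZMod 2 := Pi.single (.inl i) 1 with hx
  set y : l ⊕ l → ZMod 2 := Pi.single (.inl j) 1 with hy
  have hx0 : x ≠ 0 := fun h => by simpa [hx] using congrFun h (.inl i)
  have hy0 : y ≠ 0 := fun h => by simpa [hy] using congrFun h (.inl j)
  have hxy0 : x + y ≠ 0 := fun h => by simpa [hx, hy, hij] using congrFun h (.inl i)
  have hform : form x y = 0 := by simp [form_eq_sum, hx, hy]
  have := quadForm_add w x y
  rw [hne x hx0, hne y hy0, hne _ hxy0, hform] at this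
  exact absurd this (by decide)

/-- Dye's theorem: every symplectic matrix over `𝔽₂` preserves a quadratic form polarizing to
the symplectic form. -/
theorem exists_mem_orthogonalSubgroup (g : symplecticGroup l (ZMod 2)) :
    ∃ w, g ∈ orthogonalSubgroup w := by
  let defect : Module.Dual (ZMod 2) (l ⊕ l → ZMod 2) :=
    AddMonoidHom.toZModLinearMap 2
      { toFun := fun x => quadForm 0 (g.1 *ᵥ x) + quadForm 0 x
        map_zero' := by simp [quadForm]
        map_add' := fun x y => by
          rw [mulVec_add, quadForm_add, quadForm_add, form_mulVec]
          linear_combination CharTwo.add_self_eq_zero (form x y) }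
  have hdefect : ∀ x, defect x = quadForm 0 (g.1 *ᵥ x) + quadForm 0 x := fun x => rfl
  let f : (l ⊕ l → ZMod 2) →ₗ[ZMod 2] (l ⊕ l → ZMod 2) := g.1.mulVecLin + LinearMap.id
  have hf : ∀ x, f x = g.1 *ᵥ x + x := fun x => rfl
  have hmem : defect ∈ LinearMap.range f.dualMap := by
    rw [LinearMap.range_dualMap_eq_dualAnnihilator_ker, Submodule.mem_dualAnnihilator]
    intro x hx
    rw [LinearMap.mem_ker, hf, add_eq_zero_iff_eq] at hx
    rw [hdefect, hx, CharTwo.add_self_eq_zero]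
  obtain ⟨φ, hφ⟩ := hmem
  refine ⟨(dotProductEquiv (ZMod 2) (l ⊕ l)).symm φ, fun x => ?_⟩
  have hdot : ∀ y, (dotProductEquiv (ZMod 2) (l ⊕ l)).symm φ ⬝ᵥ y = φ y := fun y =>
    congrArg (fun ψ : Module.Dual (ZMod 2) (l ⊕ l → ZMod 2) => ψ y)
      ((dotProductEquiv (ZMod 2) (l ⊕ l)).apply_symm_apply φ)
  have hx : φ (g.1 *ᵥ x) + φ x = quadForm 0 (g.1 *ᵥ x) + quadForm 0 x := by
    rw [← hdefect, ← hφ, LinearMap.dualMap_apply, hf, map_add]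
  simp only [quadForm, zero_dotProduct, add_zero] at hx
  rw [quadForm, quadForm, hdot, hdot, ← CharTwo.add_eq_zero]
  linear_combination hx + CharTwo.add_self_eq_zero (∑ i, (g.1 *ᵥ x) (.inl i) * (g.1 *ᵥ x) (.inr i))
    + CharTwo.add_self_eq_zero (∑ i, x (.inl i) * x (.inr i))

end UpperBound

section Codes

/-- The mask of the lowest bit of every byte of a 64-bit number. -/
def lowBits : ℕ := 72340172838076673

/-- Contribution of the `k`-th column of `a` and the `k`-th row of `b` to the product. -/
def outerTerm (a b k : ℕ) : ℕ :=
  Nat.mul (Nat.land (Nat.shiftRight a (Nat.mul 8 k)) 255) (Nat.land (Nat.shiftRight b k) lowBits)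

/-- Product of codes of `8 × 8` matrices over `𝔽₂`; entry `(i, j)` is bit `i + 8 * j`. -/
def mulCode (a b : ℕ) : ℕ :=
  Nat.xor (outerTerm a b 0) (Nat.xor (outerTerm a b 1) (Nat.xor (outerTerm a b 2)
    (Nat.xor (outerTerm a b 3) (Nat.xor (outerTerm a b 4) (Nat.xor (outerTerm a b 5)
      (Nat.xor (outerTerm a b 6) (outerTerm a b 7)))))))

/-- Code of the identity matrix. -/
def oneCode : ℕ := 9241421688590303745

/-- Swaps the two halves of a byte. -/
def swapCode (u : ℕ) : ℕ := Nat.lor (Nat.shiftRight u 4) (Nat.shiftLeft (Nat.land u 15) 4)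

/-- Moves bit `j` of a byte to bit `8 * j`. -/
def spreadCode (u : ℕ) : ℕ :=
  Nat.lor (Nat.land (Nat.mul (Nat.land u 127) 567382630219905) lowBits)
    (Nat.shiftLeft (Nat.shiftRight u 7) 56)

/-- Code of the transvection with centre `u`. -/
def transvectionCode (u : ℕ) : ℕ :=
  Nat.xor oneCode (Nat.mul u (spreadCode (swapCode u)))

/-- Evaluates `n` before passing it on. -/
noncomputable def strict {α : Type} (n : ℕ) (f : ℕ → α) : α :=
  Nat.rec (f 0) (fun m _ => f (m + 1)) n

/-- Bit test through arithmetic that the kernel evaluates quickly. -/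
def hasBit (m i : ℕ) : Bool := Nat.beq (Nat.land (Nat.shiftRight m i) 1) 1

/-- The only candidate for the centre of a transvection with code `h`. -/
def centreCode (h : ℕ) : ℕ :=
  let t := Nat.xor h oneCode
  let t := Nat.lor t (Nat.shiftRight t 32)
  let t := Nat.lor t (Nat.shiftRight t 16)
  Nat.land (Nat.lor t (Nat.shiftRight t 8)) 255

theorem strict_eq {α : Type} (n : ℕ) (f : ℕ → α) : strict n f = f n := by
  cases n <;> rfl

theorem hasBit_eq (m i : ℕ) : hasBit m i = m.testBit i := by
  have h : (m >>> i) &&& 1 = 1 ↔ m.testBit i = true := by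
    rw [Nat.and_one_is_mod, Nat.testBit_eq_decide_div_mod_eq, Nat.shiftRight_eq_div_pow]
    simp
  rw [Bool.eq_iff_iff, ← h]
  exact iff_of_eq Nat.beq_eq

theorem testBit_mul_of_dvd {r i : ℕ} (hr : r < 256) (hi : i < 8) (j : ℕ) :
    ∀ c : ℕ, (∀ n, c.testBit n = true → 8 ∣ n) →
      (r * c).testBit (i + 8 * j) = (r.testBit i && c.testBit (8 * j)) := by
  have hsplit : ∀ c : ℕ, (∀ n, c.testBit n = true → 8 ∣ n) →
      r * c = 2 ^ 8 * (r * (c / 256)) + bif c.testBit 0 then r else 0 := by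
    intro c hc
    have hmod : c % 256 = bif c.testBit 0 then 1 else 0 := by
      refine Nat.eq_of_testBit_eq fun n => ?_
      rw [show 256 = 2 ^ 8 from rfl, Nat.testBit_mod_two_pow]
      rcases Nat.eq_zero_or_pos n with rfl | hn
      · cases h : c.testBit 0 <;> simp
      · have h0 : (decide (n < 8) && c.testBit n) = false := by
          by_contra h
          simp only [Bool.not_eq_false, Bool.and_eq_true, decide_eq_true_eq] at h
          have := hc n h.2
          omega
        rw [h0]
        cases c.testBit 0
        · simp
        · rw [cond_true, ← pow_zero 2, Nat.testBit_two_pow_of_ne hn.ne]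
    have hdiv := Nat.div_add_mod c 256
    rw [hmod] at hdiv
    cases h : c.testBit 0 <;> simp only [h, cond_true, cond_false] at hdiv ⊢ <;>
      (conv_lhs => rw [← hdiv]) <;> ring
  induction j with
  | zero =>
    intro c hc
    have hlt : (bif c.testBit 0 then r else 0) < 2 ^ 8 := by cases c.testBit 0 <;> simp [hr]
    rw [hsplit c hc, Nat.testBit_two_pow_mul_add _ hlt]
    simp only [mul_zero, add_zero, hi, if_true]
    cases c.testBit 0 <;> simp
  | succ j ih =>
    intro c hc
    have hlt : (bif c.testBit 0 then r else 0) < 2 ^ 8 := by cases c.testBit 0 <;> simp [hr]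
    have hc' : ∀ n, (c / 256).testBit n = true → 8 ∣ n := by
      intro n hn
      rw [show 256 = 2 ^ 8 from rfl, Nat.testBit_div_two_pow] at hn
      have := hc _ hn
      omega
    rw [hsplit c hc, Nat.testBit_two_pow_mul_add _ hlt, if_neg (by omega),
      show i + 8 * (j + 1) - 8 = i + 8 * j by omega, ih _ hc', show 256 = 2 ^ 8 from rfl,
      Nat.testBit_div_two_pow]
    rfl

theorem testBit_lowBits_of_lt {j : ℕ} (hj : j < 8) : lowBits.testBit (8 * j) = true := by
  revert j; decide

theorem dvd_of_testBit_lowBits {n : ℕ} (h : lowBits.testBit n = true) : 8 ∣ n := by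
  by_cases hn : n < 64
  · revert h
    revert n
    decide
  · rw [Nat.testBit_lt_two_pow (lt_of_lt_of_le (show lowBits < 2 ^ 64 by decide)
      (Nat.pow_le_pow_right (by norm_num) (not_lt.1 hn)))] at h
    exact absurd h (by decide)

theorem testBit_outerTerm {i j k : ℕ} (a b : ℕ) (hi : i < 8) (hj : j < 8) :
    (outerTerm a b k).testBit (i + 8 * j) = (a.testBit (i + 8 * k) && b.testBit (k + 8 * j)) := by
  change (((a >>> (8 * k)) &&& 255) * ((b >>> k) &&& lowBits)).testBit (i + 8 * j) = _
  rw [testBit_mul_of_dvd (lt_of_le_of_lt Nat.and_le_right (by norm_num)) hi]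
  · have h255 : Nat.testBit 255 i = true := by
      revert i; decide
    simp [h255, testBit_lowBits_of_lt hj, add_comm]
  · intro n hn
    rw [Nat.testBit_and, Bool.and_eq_true] at hn
    exact dvd_of_testBit_lowBits hn.2

theorem testBit_mulCode {i j : ℕ} (a b : ℕ) (hi : i < 8) (hj : j < 8) :
    (mulCode a b).testBit (i + 8 * j) =
      ((a.testBit (i + 8 * 0) && b.testBit (0 + 8 * j)) ^^
      ((a.testBit (i + 8 * 1) && b.testBit (1 + 8 * j)) ^^
      ((a.testBit (i + 8 * 2) && b.testBit (2 + 8 * j)) ^^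
      ((a.testBit (i + 8 * 3) && b.testBit (3 + 8 * j)) ^^
      ((a.testBit (i + 8 * 4) && b.testBit (4 + 8 * j)) ^^
      ((a.testBit (i + 8 * 5) && b.testBit (5 + 8 * j)) ^^
      ((a.testBit (i + 8 * 6) && b.testBit (6 + 8 * j)) ^^
      (a.testBit (i + 8 * 7) && b.testBit (7 + 8 * j))))))))) := by
  simp only [← testBit_outerTerm a b hi hj]
  change (outerTerm a b 0 ^^^ (outerTerm a b 1 ^^^ (outerTerm a b 2 ^^^ (outerTerm a b 3 ^^^
    (outerTerm a b 4 ^^^ (outerTerm a b 5 ^^^ (outerTerm a b 6 ^^^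
      outerTerm a b 7))))))).testBit (i + 8 * j) = _
  simp only [Nat.testBit_xor]

/-- Position of a coordinate inside a byte. -/
def coord : Fin 4 ⊕ Fin 4 → ℕ := Sum.elim (fun i => i.val) (fun i => i.val + 4)

theorem coord_lt (i : Fin 4 ⊕ Fin 4) : coord i < 8 := by
  revert i; decide

/-- A bit as an element of `𝔽₂`. -/
def bit (b : Bool) : ZMod 2 := bif b then 1 else 0

theorem bit_and (a b : Bool) : bit (a && b) = bit a * bit b := by
  revert a b; decide

theorem bit_xor (a b : Bool) : bit (a ^^ b) = bit a + bit b := by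
  revert a b; decide

/-- The matrix with a given code. -/
def decodeMatrix (a : ℕ) : Matrix (Fin 4 ⊕ Fin 4) (Fin 4 ⊕ Fin 4) (ZMod 2) :=
  of fun i j => bit (a.testBit (coord i + 8 * coord j))

/-- The vector with a given code. -/
def decodeVec (x : ℕ) : Fin 4 ⊕ Fin 4 → ZMod 2 := fun i => bit (x.testBit (coord i))

theorem decodeMatrix_mulCode (a b : ℕ) :
    decodeMatrix (mulCode a b) = decodeMatrix a * decodeMatrix b := by
  ext i j
  simp only [decodeMatrix, of_apply, testBit_mulCode a b (coord_lt i) (coord_lt j), bit_xor,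
    bit_and, Matrix.mul_apply, Fintype.sum_sum_type, Fin.sum_univ_four]
  simp [coord, add_assoc]

theorem decodeVec_mulCode (a x : ℕ) : decodeVec (mulCode a x) = decodeMatrix a *ᵥ decodeVec x := by
  ext i
  have h := testBit_mulCode a x (coord_lt i) (show 0 < 8 by norm_num)
  simp only [mul_zero, add_zero] at h
  simp only [decodeMatrix, decodeVec, of_apply, h, bit_xor,
    bit_and, Matrix.mulVec, dotProduct, Fintype.sum_sum_type, Fin.sum_univ_four]
  simp [coord, add_assoc]

theorem decodeMatrix_oneCode : decodeMatrix oneCode = 1 := by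
  ext i j
  rw [decodeMatrix, of_apply, Matrix.one_apply]
  revert i j
  decide

theorem exists_decodeVec_eq (x : Fin 4 ⊕ Fin 4 → ZMod 2) : ∃ n < 256, decodeVec n = x := by
  have hinj : Function.Injective fun n : Fin 256 => decodeVec n.val := by
    intro m n hmn
    refine Fin.ext (Nat.eq_of_testBit_eq fun i => ?_)
    by_cases hi : i < 8
    · obtain ⟨c, rfl⟩ : ∃ c, coord c = i := by
        revert i; decide
      have hbit : Function.Injective bit := by decide
      exact hbit (congrFun hmn c)
    · have hpow : 2 ^ 8 ≤ 2 ^ i := Nat.pow_le_pow_right (by norm_num) (not_lt.1 hi)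
      rw [Nat.testBit_lt_two_pow (lt_of_lt_of_le m.2 hpow),
        Nat.testBit_lt_two_pow (lt_of_lt_of_le n.2 hpow)]
  have hbij := (Fintype.bijective_iff_injective_and_card _).2 ⟨hinj, by simp⟩
  obtain ⟨n, hn⟩ := hbij.2 x
  exact ⟨n, n.2, hn⟩

theorem spreadCode_swapCode_check :
    ((List.range 256).all fun u =>
      Nat.beq (Nat.land (spreadCode (swapCode u)) lowBits) (spreadCode (swapCode u)) &&
      (List.range 8).all fun j =>
        hasBit (spreadCode (swapCode u)) (8 * j) == hasBit u ((j + 4) % 8)) = true := by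
  decide +kernel

theorem spreadCode_swapCode_spec {u : ℕ} (hu : u < 256) :
    spreadCode (swapCode u) &&& lowBits = spreadCode (swapCode u) ∧
      ∀ j : Fin 4 ⊕ Fin 4, (spreadCode (swapCode u)).testBit (8 * coord j) =
        u.testBit (coord j.swap) := by
  have h := List.all_eq_true.1 spreadCode_swapCode_check u (List.mem_range.2 hu)
  rw [Bool.and_eq_true] at h
  refine ⟨Nat.eq_of_beq_eq_true h.1, fun j => ?_⟩
  have hj := List.all_eq_true.1 h.2 (coord j) (List.mem_range.2 (coord_lt j))
  have hswap : (coord j + 4) % 8 = coord j.swap := by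
    clear hj
    revert j
    decide
  rwa [hswap, beq_iff_eq, hasBit_eq, hasBit_eq] at hj

theorem transvectionCode_eq (u : ℕ) :
    transvectionCode u = oneCode ^^^ (u * spreadCode (swapCode u)) := rfl

theorem decodeMatrix_transvectionCode {u : ℕ} (hu : u < 256) :
    decodeMatrix (transvectionCode u) = (transvection (decodeVec u)).1 := by
  ext i j
  obtain ⟨hlow, hspread⟩ := spreadCode_swapCode_spec hu
  have hone := congrFun (congrFun decodeMatrix_oneCode i) j
  have hJ : (J (Fin 4) (ZMod 2) *ᵥ decodeVec u) j = bit (u.testBit (coord j.swap)) := by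
    rcases j with j | j <;>
      simp [J, fromBlocks_mulVec, ZModModule.neg_eq_self, decodeVec]
  rw [decodeMatrix, of_apply] at hone
  have hval : (transvection (decodeVec u)).1 i j = (1 : Matrix _ _ (ZMod 2)) i j +
      decodeVec u i * bit (u.testBit (coord j.swap)) := by
    rw [← hJ]
    rfl
  rw [hval, decodeMatrix, of_apply, transvectionCode_eq, Nat.testBit_xor,
    testBit_mul_of_dvd hu (coord_lt i), hspread, bit_xor, bit_and, hone, decodeVec]
  intro n hn
  rw [← hlow, Nat.testBit_and, Bool.and_eq_true] at hn
  exact dvd_of_testBit_lowBits hn.2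

/-- The group `Sp(8, 2)`. -/
abbrev Sp8 := symplecticGroup (Fin 4) (ZMod 2)

/-- `a` is the code of the matrix of `g`. -/
def Codes (a : ℕ) (g : Sp8) : Prop := decodeMatrix a = g.1

theorem Codes.mul {a b : ℕ} {g h : Sp8} (ha : Codes a g) (hb : Codes b h) :
    Codes (mulCode a b) (g * h) := by
  rw [Codes, decodeMatrix_mulCode, ha, hb, Submonoid.coe_mul]

theorem Codes.unique {a : ℕ} {g h : Sp8} (hg : Codes a g) (hh : Codes a h) : g = h :=
  Subtype.ext (hg.symm.trans hh)

theorem codes_oneCode : Codes oneCode 1 := decodeMatrix_oneCode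

theorem codes_transvectionCode {u : ℕ} (hu : u < 256) :
    Codes (transvectionCode u) (transvection (decodeVec u)) :=
  decodeMatrix_transvectionCode hu

/-- The product of the transvections with the listed centres. -/
def wordElem (L : List ℕ) : Sp8 := (L.map fun u => transvection (decodeVec u)).prod

/-- Code of `wordElem`. -/
def wordCode (L : List ℕ) : ℕ := L.foldr (fun u c => mulCode (transvectionCode u) c) oneCode

theorem wordCode_cons (u : ℕ) (L : List ℕ) :
    wordCode (u :: L) = mulCode (transvectionCode u) (wordCode L) := by
  rw [wordCode, List.foldr_cons, wordCode]

theorem wordElem_cons (u : ℕ) (L : List ℕ) :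
    wordElem (u :: L) = transvection (decodeVec u) * wordElem L := by
  rw [wordElem, List.map_cons, List.prod_cons, wordElem]

theorem codes_wordCode {L : List ℕ} (hL : ∀ u ∈ L, u < 256) : Codes (wordCode L) (wordElem L) := by
  induction L with
  | nil =>
    rw [wordCode, List.foldr_nil, wordElem, List.map_nil, List.prod_nil]
    exact codes_oneCode
  | cons u L ih =>
    rw [List.forall_mem_cons] at hL
    rw [wordCode_cons, wordElem_cons]
    exact (codes_transvectionCode hL.1).mul (ih hL.2)

theorem wordElem_reverse (L : List ℕ) : wordElem L.reverse = (wordElem L)⁻¹ := by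
  rw [wordElem, wordElem, List.prod_inv_reverse, List.map_reverse, List.map_map]
  congr 2
  exact List.map_congr_left fun u _ => (transvection_inv _).symm

/-- `t` lists the codes of the first 17 powers of `wordElem L`. -/
def powCheck (t L : List ℕ) : Bool :=
  L.all (Nat.blt · 256) && (Nat.beq (t.getD 0 0) oneCode && (Nat.beq (t.getD 1 0) (wordCode L) &&
    (List.range 16).all fun e =>
      Nat.beq (t.getD (e + 1) 0) (mulCode (t.getD e 0) (t.getD 1 0))))

theorem codes_getD_pow {t : List ℕ} {o w : ℕ} {g : Sp8} (ho : Codes o 1) (hw : Codes w g)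
    (h0 : t.getD 0 0 = o) (h1 : t.getD 1 0 = w)
    (hstep : ∀ e < 16, t.getD (e + 1) 0 = mulCode (t.getD e 0) (t.getD 1 0)) (e : ℕ) :
    e < 17 → Codes (t.getD e 0) (g ^ e) := by
  induction e with
  | zero =>
    intro _
    rw [h0, pow_zero]
    exact ho
  | succ e ih =>
    intro he
    rw [hstep e (by omega), pow_succ, h1]
    exact (ih (by omega)).mul hw

theorem codes_pow {t L : List ℕ} (h : powCheck t L = true) :
    ∀ e < 17, Codes (t.getD e 0) (wordElem L ^ e) := by
  rw [powCheck, Bool.and_eq_true, Bool.and_eq_true, Bool.and_eq_true] at h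
  obtain ⟨hL, h0, h1, hstep⟩ := h
  rw [List.all_eq_true] at hL hstep
  exact codes_getD_pow codes_oneCode (codes_wordCode fun u hu => Nat.le_of_ble_eq_true (hL u hu))
    (Nat.eq_of_beq_eq_true h0) (Nat.eq_of_beq_eq_true h1)
    fun e he => Nat.eq_of_beq_eq_true (hstep e (List.mem_range.2 he))

/-- The transvection whose centre has code `v` lies in `H`. -/
def HasCentre (H : Subgroup Sp8) (v : ℕ) : Prop := transvection (decodeVec v) ∈ H

theorem HasCentre.mulCode {H : Subgroup Sp8} {v a : ℕ} {g : Sp8} (hv : HasCentre H v)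
    (ha : Codes a g) (hg : g ∈ H) : HasCentre H (mulCode a v) := by
  rw [HasCentre, decodeVec_mulCode, ha, transvection_mulVec_eq_conj]
  exact H.mul_mem (H.mul_mem hg hv) (H.inv_mem hg)

/-- Mask of the vectors reached from the mask `m` and the list of codes under the matrices with
codes `s` and `t`. The first explicit number bounds the number of steps. -/
noncomputable def orbitMask (s t : ℕ) : ℕ → ℕ → List ℕ → ℕ
  | 0, m, _ => m
  | _ + 1, m, [] => m
  | n + 1, m, x :: q => strict x fun x => bif hasBit m x then orbitMask s t n m q else
      strict (Nat.lor m (Nat.shiftLeft 1 x)) fun m =>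
        orbitMask s t n m (mulCode s x :: mulCode t x :: q)

theorem hasCentre_of_orbitMask {H : Subgroup Sp8} {s t : ℕ} {g h : Sp8} (hs : Codes s g)
    (ht : Codes t h) (hg : g ∈ H) (hh : h ∈ H) :
    ∀ (n m : ℕ) (q : List ℕ), (∀ x, m.testBit x = true → HasCentre H x) →
      (∀ x ∈ q, HasCentre H x) →
      ∀ x, (orbitMask s t n m q).testBit x = true → HasCentre H x
  | 0, _, _, hm, _ => by simpa only [orbitMask] using hm
  | _ + 1, _, [], hm, _ => by simpa only [orbitMask] using hm
  | n + 1, m, x :: q, hm, hq => by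
    rw [List.forall_mem_cons] at hq
    simp only [orbitMask, strict_eq]
    cases hasBit m x
    · refine hasCentre_of_orbitMask hs ht hg hh n _ _ (fun y hy => ?_) ?_
      · change (m ||| (1 <<< x)).testBit y = true at hy
        rw [Nat.testBit_or, Nat.one_shiftLeft, Nat.testBit_two_pow, Bool.or_eq_true,
          decide_eq_true_eq] at hy
        rcases hy with hy | rfl
        · exact hm y hy
        · exact hq.1
      · rw [List.forall_mem_cons, List.forall_mem_cons]
        exact ⟨hq.1.mulCode hs hg, hq.1.mulCode ht hh, hq.2⟩
    · exact hasCentre_of_orbitMask hs ht hg hh n _ _ hm hq.2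

/-- In a subgroup containing `g`, one transvection with centre in `regular` yields all of them,
and one transvection with centre in `singular` yields the whole group. -/
def Spreads (g : Sp8) (regular singular : ℕ) : Prop :=
  ∀ H : Subgroup Sp8, g ∈ H → ∀ v, HasCentre H v →
    (regular.testBit v = true → ∀ w, regular.testBit w = true → HasCentre H w) ∧
    (singular.testBit v = true → H = ⊤)

/-- Mask of the nonzero vectors. -/
def nonzeroMask : ℕ := 2 ^ 256 - 2

/-- Every vector of `mask` is moved into `reps` by a power listed in `t`, and each representative
reaches all of `target`. -/
noncomputable def orbitCheck (t : List ℕ) (mask target : ℕ) (reps : List ℕ) : Bool :=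
  Nat.blt mask (2 ^ 256) && (((List.range 256).all fun v => !hasBit mask v ||
    (List.range 17).any fun e => strict (mulCode (t.getD e 0) v) fun w => reps.any (Nat.beq w)) &&
  reps.all fun r => Nat.blt r 256 &&
    Nat.beq (Nat.land (orbitMask (t.getD 1 0) (transvectionCode r) 512 0 [r]) target) target)

theorem hasCentre_of_orbitCheck {t L reps : List ℕ} {mask target : ℕ}
    (ht : powCheck t L = true) (h : orbitCheck t mask target reps = true) {H : Subgroup Sp8}
    (hg : wordElem L ∈ H) {v w : ℕ} (hv : HasCentre H v) (hmask : mask.testBit v = true)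
    (hw : target.testBit w = true) : HasCentre H w := by
  simp only [orbitCheck, Bool.and_eq_true, List.all_eq_true, Nat.blt_eq, List.mem_range,
    Bool.or_eq_true, List.any_eq_true, strict_eq, hasBit_eq, Nat.beq_eq] at h
  obtain ⟨hlt, hreps, horbit⟩ := h
  have hv256 : v < 256 := by
    by_contra hge
    rw [Nat.testBit_lt_two_pow (lt_of_lt_of_le hlt (Nat.pow_le_pow_right (by norm_num)
      (not_lt.1 hge)))] at hmask
    exact absurd hmask (by decide)
  rcases hreps v hv256 with hv' | ⟨e, he, r, hr, hrv⟩
  · rw [hmask] at hv'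
    exact absurd hv' (by decide)
  · have hcodes := codes_pow ht
    obtain ⟨hr256, hall⟩ := horbit r hr
    have hcr : HasCentre H r := hrv ▸ hv.mulCode (hcodes e he) (H.pow_mem hg e)
    have hone := hcodes 1 (by norm_num)
    rw [pow_one] at hone
    refine hasCentre_of_orbitMask hone (codes_transvectionCode hr256) hg hcr 512 0 [r]
      (by simp) (by simpa using hcr) w ?_
    change _ &&& target = target at hall
    rw [← hall, Nat.testBit_and, Bool.and_eq_true] at hw
    exact hw.1

theorem eq_top_of_hasCentre {H : Subgroup Sp8}
    (h : ∀ w, nonzeroMask.testBit w = true → HasCentre H w) : H = ⊤ := by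
  refine eq_top_of_transvection_mem fun u => ?_
  obtain ⟨n, hn, rfl⟩ := exists_decodeVec_eq u
  rcases Nat.eq_zero_or_pos n with rfl | hpos
  · have : decodeVec 0 = 0 := by
      ext i
      simp [decodeVec, bit]
    rw [this, transvection_zero]
    exact H.one_mem
  · refine h n ?_
    rw [nonzeroMask, show 2 ^ 256 - 2 = 2 ^ 256 - (1 + 1) from rfl,
      Nat.testBit_two_pow_sub_succ (by norm_num)]
    have h1 : Nat.testBit 1 n = false := by
      rw [← pow_zero 2, Nat.testBit_two_pow_of_ne hpos.ne]
    simp [h1, hn]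

theorem spreads_of_orbitCheck {t L reps reps' : List ℕ} {regular singular : ℕ}
    (ht : powCheck t L = true) (h1 : orbitCheck t regular regular reps = true)
    (h0 : orbitCheck t singular nonzeroMask reps' = true) : Spreads (wordElem L) regular singular :=
  fun _ hg _ hv => ⟨fun hone _ hw => hasCentre_of_orbitCheck ht h1 hg hv hone hw,
    fun hzero => eq_top_of_hasCentre fun _ hw => hasCentre_of_orbitCheck ht h0 hg hv hzero hw⟩

/-- The seventh power of the product of the matrices with codes `s` and `b` is a transvection with
centre in `singular`, or with centre in `regular` while `b` moves some vector of `regular` into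
`singular`. -/
noncomputable def transvectionCheck (regular singular s b : ℕ) : Bool :=
  strict (mulCode s b) fun h =>
  strict (mulCode h h) fun h2 =>
  strict (mulCode h2 h) fun h3 =>
  strict (mulCode h3 h3) fun h6 =>
  strict (mulCode h6 h) fun h7 =>
  strict (centreCode h7) fun u =>
    Nat.blt u 256 && (Nat.beq h7 (transvectionCode u) &&
      (hasBit singular u || (hasBit regular u &&
        (List.range 256).any fun w => hasBit regular w && hasBit singular (mulCode b w))))

theorem eq_top_of_transvectionCheck {H : Subgroup Sp8} {g p b : Sp8} {regular singular s c : ℕ}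
    (hspread : Spreads g regular singular) (hg : g ∈ H) (hp : p ∈ H) (hb : b ∈ H) (hs : Codes s p)
    (hc : Codes c b) (h : transvectionCheck regular singular s c = true) : H = ⊤ := by
  simp only [transvectionCheck, strict_eq, Bool.and_eq_true, Bool.or_eq_true, List.any_eq_true,
    hasBit_eq, Nat.beq_eq, Nat.blt_eq, List.mem_range] at h
  generalize centreCode _ = u at h
  obtain ⟨hu, htv, h⟩ := h
  have h1 := hs.mul hc
  have h2 := h1.mul h1
  have h3 := h2.mul h1
  have h7 := (h3.mul h3).mul h1
  rw [htv] at h7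
  have hcentre : HasCentre H u := by
    rw [HasCentre, (codes_transvectionCode hu).unique h7]
    have hpb := H.mul_mem hp hb
    have h3b := H.mul_mem (H.mul_mem hpb hpb) hpb
    exact H.mul_mem (H.mul_mem h3b h3b) hpb
  rcases h with h | ⟨hone, w, -, hw, hbw⟩
  · exact (hspread H hg u hcentre).2 h
  · have hw' := (hspread H hg u hcentre).1 hone w hw
    exact (hspread H hg _ (hw'.mulCode hc hb)).2 hbw

end Codes

section LowerBound

/-- Transvection centres whose transvections multiply to an element of order 17. -/
def word17 : List ℕ := [35, 146, 217, 206, 196, 17, 66, 31]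

/-- Transvection centres whose transvections multiply to an element of order 15. -/
def word15 : List ℕ := [198, 52, 139, 236, 221, 141, 60, 104]

/-- Words in transvections for the conjugating elements. -/
def conjWords : List (List ℕ) :=
  [[], [89, 244, 217, 148], [156, 246, 187, 2], [201, 220, 211, 245], [208, 34, 133, 200],
    [53, 110, 244, 15], [160, 202, 157, 85], [75, 18, 43, 41], [136, 244, 44, 169],
    [166, 183, 76, 117], [99, 88, 108, 204], [67, 28, 65, 231], [115, 181, 130, 174],
    [140, 214, 57, 251], [125, 197, 253, 137], [200, 245, 184, 228]]

/-- Codes of the powers of the element of order 17. -/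
def powCodes17 : List ℕ :=
  [9241421688590303745, 4989438440800985459, 15186972450572171444, 9897255183833514498,
    10549853330400485153, 13227459623167572600, 5829124208617723970, 17121617582747252511,
    4083998929273433018, 8937098134618897688, 15978474576689097591, 16179128914933483051,
    8108916731471461373, 16636836004518712811, 14844978773167964550, 7012755259578610683,
    5101548666936210517]

/-- Codes of the powers of the element of order 15. -/
def powCodes15 : List ℕ :=
  [9241421688590303745, 13311702784412367234, 6350854384114819713, 17839459898097610298,
    5306963869158245593, 5931392717706347213, 11717220250891206032, 3046750168573417631,
    18361276365837454130, 12043554107047439285, 15136785609009250508, 1884552603649967122,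
    8244682755985340958, 667137270396708104, 17187234963234287468, 9241421688590303745,
    13311702784412367234]

/-- Codes of the conjugating elements. -/
def conjCodes : List ℕ :=
  [9241421688590303745, 17627124558716579733, 4263257618051683148, 10781670190767816430,
    11008207704321433809, 16276080706199662016, 13681912095386804894, 12195838195825336408,
    11644092149543786365, 14729077359751554755, 1508498565435176506, 11305963233136654365,
    6712838265679321543, 1736842461116176067, 12788007307711414268, 17359442410108949324]

/-- Codes of the inverses of the conjugating elements. -/
def conjInvCodes : List ℕ :=
  [9241421688590303745, 6987652516247318360, 2058549277951545193, 12950930903220221736,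
    5243600181690376217, 16276080706199662016, 2296122836781525660, 15654585186181851411,
    6138723748925201141, 14729077359751554755, 1453667929861649913, 8889124981377000954,
    3375821170876859497, 928081076139638828, 8390523489801830268, 1463987524171812776]

/-- Mask of the vectors with value 1 under the quadratic form fixed by the element of order 17. -/
def oneMask17 : ℕ :=
  115340951982662362614833605542785475461819465088996847721585410115616404379286

/-- Orbit representatives for `oneMask17` under the element of order 17. -/
def oneReps17 : List ℕ := [1, 4, 7, 9, 10, 15, 22, 56]

/-- Mask of the vectors with value 0 under the quadratic form fixed by the element of order 17,
zero excepted. -/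
def zeroMask17 : ℕ :=
  451137254653832808737379465902432391450519576643716317872173892296725260648

/-- Orbit representatives for `zeroMask17` under the element of order 17. -/
def zeroReps17 : List ℕ := [3, 5, 11, 13, 14, 21, 27]

/-- Mask of the vectors with value 1 under the quadratic form fixed by the element of order 15. -/
def oneMask15 : ℕ :=
  68032865608675673729749383242078063574702134686248703768424606049336828755968

/-- Orbit representatives for `oneMask15` under the element of order 15. -/
def oneReps15 : List ℕ := [17, 21, 23, 25, 27, 31, 33, 40]

/-- Mask of the vectors with value 0 under the quadratic form fixed by the element of order 15,
except those in its invariant isotropic 4-spaces. -/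
def zeroMask15 : ℕ :=
  47759201951105645594785432437732107206237751031251542138669816417138297395198

/-- Orbit representatives for `zeroMask15` under the element of order 15. -/
def zeroReps15 : List ℕ := [1, 2, 3, 5, 6, 9, 16]

/-- Byte `k` of entry `(i, j)` holds the exponents `e - 1` and `f - 1` of a word `x ^ e * y ^ f`
whose seventh power is a transvection. -/
def exponentCodes : List (List ℕ) :=
  [[0, 10931737842416972128203783466984490934304, 49534437098451904955923393834773474546065,
      43726951369667888512815133867937963737216, 60124558133293346705120809068414700138672,
      49192820290876374576917025601430209204368, 44410184984818949270827870334624494420610,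
      38602699256034932827719610367788983611761, 76522164896918804897426484268891436540128,
      49192820290876374576917025601430209204368, 0, 27329344606042430320509458667461227335760,
      71739529590861379591337329002085721756370, 22205092492409474635413935167312247210305,
      27329344606042430320509458667461227335760, 76522164896918804897426484268891436540128],
    [0, 27244107555318966857236555492789421355008, 70801080627250198798744860235869935739648,
      21991831243282426512393850216620220235889, 11358258148900473707031617393208208662593,
      5593644861745129855979239908895978692737, 77330502312089469100326397892092560937712,
      65674664595804871522712535316365108662305, 60380183014314102608292518718646384717936,
      1299495930531194384877840418390422855826, 16737642174467432068899630175426355138944,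
      5742934455297991051211431499709474160753, 49340943561098016988018989545072541831456,
      70970487421123798486059020206225320079600, 71055959442324502313601046315448294047858,
      60614132337568110011170663394112554664385],
    [0, 0, 60017554941204747681039918010593771032576, 11082448483879826896335511003166663512481,
      25174526825121578547284875407287963680, 17249977786899382916376686166687948472480,
      468729092240005142226337488627688288273, 21822118088335219315214161214771181928464,
      60082113071308398645484794544438115385632, 27478134092612210646522926106799437275280,
      11293455003380422059782281074173746888768, 5487224850859312911897536632027534667824,
      5513641298765283091725983976828153368752, 21992247901078820675598729888795969249888,
      22013179691303179893654557243539067015312, 16525628114925912636992169065422694404304],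
    [0, 0, 0, 574315114488729515947455494844266385408, 65632383083436220320417549387599144050784,
      27502060518509531892588165803493122162752, 11080945987022310090971305996526585696561,
      5466786663604958485265381501353332834368, 59954414018989816995972228803898154959488,
      16801941951080524782214794459826367860816, 33028664386481025076411603473464506192240,
      5806155537319402399446600094283279114944, 49320262310511566152219925577519025123696,
      5637672292499006797458410224720929656928, 85487932751309605762907699120682643553,
      59932735205029862401652018103094398169120],
    [0, 0, 0, 0, 22331871180963378913210232048540678430720,
      108500203817404047082568692519982334080, 32796137757344453909052699647682194460929,
      16357239599154238137304581909469050531856, 76309236252866489684619273598466615500944,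
      21842125620622429046693773803128645279776, 22267896625048989115545860555647389549361,
      1234608771464478400996089081776142656256, 5465958833125482435813304652957052076320,
      43917692992162747118930051721604613816354, 1009584940342264174492502194203644449,
      71842117014433865573818561601802889986512],
    [0, 0, 0, 0, 0, 22225445319914624222057844900423262093312,
      33690198069320150298055631875404129636593, 16568579727450919605375429073762389086368,
      27222591649400237031163166535591835729920, 22249867601318073550723404335680191496195,
      5447094568343725978588718363728288948305, 76265874102607599150910465589484216012848,
      22075902609485773616475464286039013613713, 191413727124021125664102553081545240673,
      54849601201759247208943632255493850824848, 16398604015578506183650472840101782131200],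
    [0, 0, 0, 0, 0, 0, 16334386983511388815459680869799145005056,
      5848769986703833548472744776350372512003, 11188949364352821702381369818325730754993,
      5466451760329360011835771614482361520161, 333612788139724114679779945739219040,
      27329937839996892994910478046782039318544, 5466622132609141699214165120681250914304,
      60187942161633028856636882078490615111904, 16376263868047430656124406527893507690528,
      5445275307180924504930452800735744679952],
    [0, 0, 0, 0, 0, 0, 0, 32837421709696876965869314199665804079104,
      16427603962033182228611141795428343771360, 21802264667025353971836736982972805210226,
      21970483077951372741328761427751711301648, 405755295931803290877069976321384358114,
      43705931671638189843467204783268914294960, 55020077929768682033523172277650941108224,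
      60548994338399579030777747211247174029425, 82008311684406547274763451895111544213520],
    [0, 0, 0, 0, 0, 0, 0, 0, 5662106590081609252681563216019583992064,
      32755004063440955873461925436549956153408, 5487058692467384552692256343174309552961,
      44241128291737255220839762939269485871712, 16909112912977734274772023499562604827392,
      16930462718751626845292419859207427362867, 44046800444853256161806133437440362365378,
      49363128639505598393214076995697539879267],
    [0, 0, 0, 0, 0, 0, 0, 0, 0, 16397863134639592249192506253766322827520,
      6168117666675461948064045002576495665248, 49128932641373200706531755845000472035665,
      5551361714137400685802018534098935620208, 16822794544942688547119610858184679379264,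
      66249140368250291286705425449723044561313, 724769085836164196438913594447312715904],
    [0, 0, 0, 0, 0, 0, 0, 0, 0, 0, 49426017764280439811533109084125716898048,
      49383814708318304329416412683927699951906, 38707205567100158883403523972710984159506,
      60232307069260945482056418107210157043856, 5573708405325014290924669365819588809680,
      17462234988273296956671977162481207382176],
    [0, 0, 0, 0, 0, 0, 0, 0, 0, 0, 0, 38134557543565220944660355006189620216064,
      49022178689631267698916209412965223383237, 49045939612367586074134696737643393200160,
      60061917291817863257034758815256124851154, 60021057837498684406768004404543290933409],
    [0, 0, 0, 0, 0, 0, 0, 0, 0, 0, 0, 0, 17717448059126978738337555476559410778112,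
      27414164987654299798300901668100530819121, 11570131714729684646081082826873932775490,
      49364459440611173054665496894413013516353],
    [0, 0, 0, 0, 0, 0, 0, 0, 0, 0, 0, 0, 0, 39029217222279966754723911987758743265280,
      340284653882199906492181028026316750912, 38537149426421908500036104768704673272832],
    [0, 0, 0, 0, 0, 0, 0, 0, 0, 0, 0, 0, 0, 0, 43939792715828150179122751513502134854144,
      21909757569015713526364945351708965392481],
    [0, 0, 0, 0, 0, 0, 0, 0, 0, 0, 0, 0, 0, 0, 0, 21906437082434053385385882614695691571200]]

/-- The word of the `i`-th base element: order 17 for `i < 8` and order 15 otherwise. -/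
def baseWord (i : ℕ) : List ℕ := bif Nat.blt i 8 then word17 else word15

/-- Codes of the powers of the `i`-th base element. -/
def powCodes (i : ℕ) : List ℕ := bif Nat.blt i 8 then powCodes17 else powCodes15

/-- Mask of the nonsingular vectors for the `i`-th base element. -/
def oneMask (i : ℕ) : ℕ := bif Nat.blt i 8 then oneMask17 else oneMask15

/-- Mask of the singular vectors for the `i`-th base element. -/
def zeroMask (i : ℕ) : ℕ := bif Nat.blt i 8 then zeroMask17 else zeroMask15

theorem powCheck17 : powCheck powCodes17 word17 = true := by decide +kernel

theorem powCheck15 : powCheck powCodes15 word15 = true := by decide +kernel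

theorem powCheck_base (i : ℕ) : powCheck (powCodes i) (baseWord i) = true := by
  rw [powCodes, baseWord]
  cases Nat.blt i 8
  · exact powCheck15
  · exact powCheck17

theorem spreads17 : Spreads (wordElem word17) oneMask17 zeroMask17 :=
  spreads_of_orbitCheck powCheck17
    (show orbitCheck powCodes17 oneMask17 oneMask17 oneReps17 = true by decide +kernel)
    (show orbitCheck powCodes17 zeroMask17 nonzeroMask zeroReps17 = true by decide +kernel)

theorem spreads15 : Spreads (wordElem word15) oneMask15 zeroMask15 :=
  spreads_of_orbitCheck powCheck15
    (show orbitCheck powCodes15 oneMask15 oneMask15 oneReps15 = true by decide +kernel)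
    (show orbitCheck powCodes15 zeroMask15 nonzeroMask zeroReps15 = true by decide +kernel)

theorem spreads_base (i : ℕ) : Spreads (wordElem (baseWord i)) (oneMask i) (zeroMask i) := by
  rw [baseWord, oneMask, zeroMask]
  cases Nat.blt i 8
  · exact spreads15
  · exact spreads17

theorem wordElem_word17_pow : wordElem word17 ^ 17 = 1 := by
  have h := codes_pow powCheck17
  have h17 := (h 16 (by norm_num)).mul (h 1 (by norm_num))
  rw [← pow_add, show mulCode (powCodes17.getD 16 0) (powCodes17.getD 1 0) = oneCode by
    decide +kernel] at h17
  exact h17.unique codes_oneCode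

theorem conjCodes_check :
    ((List.range 16).all fun i => (conjWords.getD i []).all (Nat.blt · 256) &&
      (Nat.beq (conjCodes.getD i 0) (wordCode (conjWords.getD i [])) &&
        Nat.beq (conjInvCodes.getD i 0) (wordCode (conjWords.getD i []).reverse))) = true := by
  decide +kernel

/-- The `i`-th conjugating element. -/
def conjElem (i : ℕ) : Sp8 := wordElem (conjWords.getD i [])

theorem codes_conjElem {i : ℕ} (hi : i < 16) :
    Codes (conjCodes.getD i 0) (conjElem i) ∧ Codes (conjInvCodes.getD i 0) (conjElem i)⁻¹ := by
  have h := List.all_eq_true.1 conjCodes_check i (List.mem_range.2 hi)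
  simp only [Bool.and_eq_true, List.all_eq_true, Nat.beq_eq, Nat.blt_eq] at h
  obtain ⟨hlt, h1, h2⟩ := h
  rw [h1, h2, conjElem, ← wordElem_reverse]
  exact ⟨codes_wordCode hlt, codes_wordCode fun u hu => hlt u (List.mem_reverse.1 hu)⟩

/-- `transvectionCheck` for the `i`-th base element and the conjugate of the `j`-th one by
`(conjElem i)⁻¹ * z ^ k * conjElem j`, where `z` is the element of order 17. -/
noncomputable def pairCheck (i j k : ℕ) : Bool :=
  strict (Nat.land (Nat.shiftRight ((exponentCodes.getD i []).getD j 0) (Nat.mul 8 k)) 255) fun c =>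
  strict ((powCodes i).getD (Nat.succ (Nat.shiftRight c 4) % 17) 0) fun s =>
  strict ((powCodes j).getD (Nat.succ (Nat.land c 15) % 17) 0) fun t =>
  strict (mulCode (conjInvCodes.getD i 0)
    (mulCode (powCodes17.getD k 0) (conjCodes.getD j 0))) fun d =>
  strict (mulCode (conjInvCodes.getD j 0)
    (mulCode (powCodes17.getD ((17 - k) % 17) 0) (conjCodes.getD i 0))) fun d' =>
  strict (mulCode d (mulCode t d')) fun b =>
    transvectionCheck (oneMask i) (zeroMask i) s b

theorem pairCheck_all :
    ((List.range 16).all fun i => (List.range 16).all fun j => (List.range 17).all fun k =>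
      Nat.blt j i || (Nat.beq i j && (Nat.beq k 0 || Nat.beq i 0) || pairCheck i j k)) = true := by
  decide +kernel

theorem eq_top_of_pairCheck {i j k : ℕ} (hi : i < 16) (hj : j < 16) (hk : k < 17)
    (h : pairCheck i j k = true) {H : Subgroup Sp8} (hg : wordElem (baseWord i) ∈ H)
    (hd : ((conjElem i)⁻¹ * (wordElem word17 ^ k * conjElem j)) * wordElem (baseWord j) *
      ((conjElem i)⁻¹ * (wordElem word17 ^ k * conjElem j))⁻¹ ∈ H) : H = ⊤ := by
  simp only [pairCheck, strict_eq] at h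
  generalize Nat.land _ 255 = c at h
  have hpow := codes_pow powCheck17
  have hinv : wordElem word17 ^ ((17 - k) % 17) = (wordElem word17 ^ k)⁻¹ := by
    rw [eq_inv_iff_mul_eq_one, ← pow_add]
    rcases Nat.eq_zero_or_pos k with rfl | hpos
    · simp
    · rw [Nat.mod_eq_of_lt (by omega), Nat.sub_add_cancel hk.le, wordElem_word17_pow]
  have hcd := (codes_conjElem hi).2.mul ((hpow k hk).mul (codes_conjElem hj).1)
  have hcd' := (codes_conjElem hj).2.mul
    ((hpow ((17 - k) % 17) (Nat.mod_lt _ (by norm_num))).mul (codes_conjElem hi).1)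
  rw [hinv] at hcd'
  have hs := codes_pow (powCheck_base i) (Nat.succ (Nat.shiftRight c 4) % 17)
    (Nat.mod_lt _ (by norm_num))
  have ht := codes_pow (powCheck_base j) (Nat.succ (Nat.land c 15) % 17)
    (Nat.mod_lt _ (by norm_num))
  refine eq_top_of_transvectionCheck (spreads_base i) hg (H.pow_mem hg _) ?_ hs
    (hcd.mul (ht.mul hcd')) h
  have hmem := H.pow_mem hd (Nat.succ (Nat.land c 15) % 17)
  rw [conj_pow] at hmem
  convert hmem using 1
  group

/-- The members of the generating family: conjugates of the base elements. -/
def member (i k : ℕ) : Sp8 :=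
  (wordElem word17 ^ k * conjElem i) * wordElem (baseWord i) * (wordElem word17 ^ k * conjElem i)⁻¹

theorem eq_top_of_member_mem_of_le {i j k m : ℕ} (hij : i ≤ j) (hj : j < 16) (hk : k < 17)
    (hm : m < 17) (hne : i = j → k ≠ m ∧ i ≠ 0) {H : Subgroup Sp8} (h1 : member i k ∈ H)
    (h2 : member j m ∈ H) : H = ⊤ := by
  set x := wordElem word17 ^ k * conjElem i with hx
  set n := (m + (17 - k)) % 17 with hn
  have hn17 : n < 17 := Nat.mod_lt _ (by norm_num)
  have hpow : wordElem word17 ^ k * wordElem word17 ^ n = wordElem word17 ^ m := by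
    have hz : wordElem word17 ^ n = wordElem word17 ^ (m + (17 - k)) :=
      (pow_eq_pow_mod _ wordElem_word17_pow).symm
    rw [hz, ← pow_add, show k + (m + (17 - k)) = m + 17 by omega, pow_add, wordElem_word17_pow,
      mul_one]
  have hcheck : pairCheck i j n = true := by
    have h := List.all_eq_true.1 pairCheck_all i (List.mem_range.2 (hij.trans_lt hj))
    have h := List.all_eq_true.1 h j (List.mem_range.2 hj)
    have h := List.all_eq_true.1 h n (List.mem_range.2 hn17)
    simp only [Bool.or_eq_true, Bool.and_eq_true, Nat.blt_eq, Nat.beq_eq] at h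
    rcases h with h | ⟨h, h'⟩ | h
    · omega
    · have := hne h
      omega
    · exact h
  have htop : H.comap (MulAut.conj x).toMonoidHom = ⊤ := by
    refine eq_top_of_pairCheck (hij.trans_lt hj) hj hn17 hcheck ?_ ?_
    · rw [Subgroup.mem_comap]
      exact h1
    · rw [Subgroup.mem_comap]
      convert h2 using 1
      rw [member, ← hpow, hx]
      simp only [MulEquiv.coe_toMonoidHom, MulAut.conj_apply]
      group
  rw [Subgroup.eq_top_iff'] at htop ⊢
  intro g
  simpa [mul_assoc] using htop (x⁻¹ * g * x)

/-- Positions of the 256 members of the generating family. -/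
def position : Option (Fin 15 × Fin 17) → ℕ × ℕ
  | none => (0, 0)
  | some (i, k) => (i.val + 1, k.val)

theorem position_injective : Function.Injective position := by
  rintro (_ | ⟨i, k⟩) (_ | ⟨j, m⟩) h
  · rfl
  · simp [position] at h
  · simp [position] at h
  · simp only [position, Prod.mk.injEq, add_left_inj, Fin.val_inj] at h
    rw [h.1, h.2]

theorem position_spec (p : Option (Fin 15 × Fin 17)) :
    (position p).1 < 16 ∧ (position p).2 < 17 ∧ ((position p).1 = 0 → (position p).2 = 0) := by
  rcases p with _ | ⟨i, k⟩
  · simp [position]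
  · exact ⟨Nat.succ_lt_succ i.2, k.2, fun h => absurd h (Nat.succ_ne_zero _)⟩

theorem eq_top_of_member_mem {p q : Option (Fin 15 × Fin 17)} (hpq : p ≠ q) {H : Subgroup Sp8}
    (hp : member (position p).1 (position p).2 ∈ H)
    (hq : member (position q).1 (position q).2 ∈ H) : H = ⊤ := by
  have hne := position_injective.ne hpq
  obtain ⟨hp1, hp2, hp3⟩ := position_spec p
  obtain ⟨hq1, hq2, hq3⟩ := position_spec q
  have hfst : (position p).1 = (position q).1 → (position p).2 ≠ (position q).2 :=
    fun h1 h2 => hne (Prod.ext h1 h2)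
  rcases le_total (position p).1 (position q).1 with h | h
  · exact eq_top_of_member_mem_of_le h hq1 hp2 hq2 (by omega) hp hq
  · exact eq_top_of_member_mem_of_le h hp1 hq2 hp2 (by omega) hq hp

theorem card_le_of_isSubgroupCover {S : Finset (Subgroup Sp8)} (hS : IsSubgroupCover S) :
    256 ≤ S.card := by
  choose f hf hmem using fun p => hS.2 (member (position p).1 (position p).2)
  have hinj : Function.Injective f := by
    intro p q hpq
    by_contra hne
    exact hS.1 _ (hf p) (eq_top_of_member_mem hne (hmem p) (hpq ▸ hmem q))
  calc 256 = (Finset.univ : Finset (Option (Fin 15 × Fin 17))).card := by simp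
    _ ≤ S.card := Finset.card_le_card_of_injOn f (fun p _ => hf p) hinj.injOn

theorem exists_isSubgroupCover :
    ∃ S : Finset (Subgroup Sp8), IsSubgroupCover S ∧ S.card ≤ 256 := by
  classical
  refine ⟨Finset.univ.image orthogonalSubgroup, ⟨?_, fun g => ?_⟩, ?_⟩
  · intro H hH
    obtain ⟨w, -, rfl⟩ := Finset.mem_image.1 hH
    exact orthogonalSubgroup_ne_top w
  · obtain ⟨w, hw⟩ := exists_mem_orthogonalSubgroup g
    exact ⟨_, Finset.mem_image_of_mem _ (Finset.mem_univ w), hw⟩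
  · exact Finset.card_image_le.trans (by simp)

end LowerBound

end SymplecticCover

theorem statement19 :
    coveringNumber ↥(Matrix.symplecticGroup (Fin 4) (ZMod 2)) = (256 : ℕ∞) := by
  refine le_antisymm ?_ (le_sInf ?_)
  · obtain ⟨S, hS, hcard⟩ := SymplecticCover.exists_isSubgroupCover
    have h : coveringNumber _ ≤ (S.card : ℕ∞) := sInf_le ⟨S, hS, rfl⟩
    exact h.trans (by exact_mod_cast hcard)
  · rintro n ⟨S, hS, rfl⟩
    exact_mod_cast SymplecticCover.card_le_of_isSubgroupCover hS
end
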